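/- Let n ≥ 1 and Γ > 1. Then there exists D > 1, depending only on Γ and the dimension n, such that for all locally finite positive Borel measures σ and ω on ℝ^n one has the two-sided equivalence N_M(σ,ω) ≈ T_M^D(Γ)(σ,ω) + √(A₂(σ,ω)), with implicit constants depending only on Γ and n. In particular, the norm inequality ∫_{ℝ^n} M(fσ)² dω ≤ C ∫_{ℝ^n} f² dσ holds for all f ≥ 0 if and only if A₂(σ,ω) < ∞ and the testing inequality ∫_Q M(1_Q σ)² dω ≤ C' σ(Q) holds for all cubes Q ∈ P^n satisfying σ(ΓQ) ≤ D σ(Q). -/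

import Mathlib

open MeasureTheory Set Filter
open scoped ENNReal NNReal

noncomputable section

/-- An axis-parallel half-open cube in `ℝⁿ`, given by its lower corner and (positive)
side length. -/
structure Cube (n : ℕ) where
  corner : Fin n → ℝ
  side : ℝ
  side_pos : 0 < side

namespace Cube

variable {n : ℕ}

/-- The underlying (half-open) set of the cube. -/
def toSet (Q : Cube n) : Set (Fin n → ℝ) :=
  {x | ∀ i, Q.corner i ≤ x i ∧ x i < Q.corner i + Q.side}

/-- The concentric dilate `ΓQ` of the cube `Q` (same center, side length `Γ·ℓ(Q)`),
as a set. -/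
def dilate (Q : Cube n) (Γ : ℝ) : Set (Fin n → ℝ) :=
  {x | ∀ i, Q.corner i - (Γ - 1) * Q.side / 2 ≤ x i ∧
       x i < Q.corner i + Q.side + (Γ - 1) * Q.side / 2}

/-- Membership in `𝒫ⁿ`: the side length is an integral power of `2`. -/
def memP (Q : Cube n) : Prop := ∃ ℓ : ℤ, Q.side = (2:ℝ) ^ ℓ

end Cube

/-- The translation applied at scale `2^ℓ` in the random dyadic grid determined by `β`:
`Σ_{j : 2^{-j} < 2^ℓ} 2^{-j} β_j`. -/
def gridShift {n : ℕ} (β : ℤ → Fin n → Bool) (ℓ : ℤ) (i : Fin n) : ℝ :=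
  ∑' j : ℤ, if (2:ℝ) ^ (-j) < (2:ℝ) ^ ℓ ∧ β j i = true then (2:ℝ) ^ (-j) else 0

/-- Membership in the shifted dyadic grid `𝒟^β`. -/
def memGrid {n : ℕ} (β : ℤ → Fin n → Bool) (Q : Cube n) : Prop :=
  ∃ (ℓ : ℤ) (k : Fin n → ℤ), Q.side = (2:ℝ) ^ ℓ ∧
    ∀ i, Q.corner i = (2:ℝ) ^ ℓ * (k i : ℝ) + gridShift β ℓ i

/-- The Hardy–Littlewood maximal function of a measure, over cubes in `𝒫ⁿ`. -/
def maximal {n : ℕ} (μ : Measure (Fin n → ℝ)) (x : Fin n → ℝ) : ℝ≥0∞ :=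
  ⨆ (Q : Cube n) (_ : Q.memP) (_ : x ∈ Q.toSet), μ Q.toSet / volume Q.toSet

/-- The dyadic maximal function relative to the grid `𝒟^β`. -/
def dyadicMaximal {n : ℕ} (β : ℤ → Fin n → Bool) (μ : Measure (Fin n → ℝ))
    (x : Fin n → ℝ) : ℝ≥0∞ :=
  ⨆ (Q : Cube n) (_ : memGrid β Q) (_ : x ∈ Q.toSet), μ Q.toSet / volume Q.toSet

/-- The two-weight Muckenhoupt constant `A₂(σ,ω)`. -/
def A2 {n : ℕ} (σ ω : Measure (Fin n → ℝ)) : ℝ≥0∞ :=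
  ⨆ (Q : Cube n) (_ : Q.memP), (σ Q.toSet / volume Q.toSet) * (ω Q.toSet / volume Q.toSet)

/-- The operator norm `𝔑_M(σ,ω)` of the maximal function from `L²(σ)` to `L²(ω)`:
the least `N` with `∫ M(fσ)² dω ≤ N² ∫ f² dσ` for all (nonnegative) `f`. -/
def opNorm {n : ℕ} (σ ω : Measure (Fin n → ℝ)) : ℝ≥0∞ :=
  sInf {N : ℝ≥0∞ | ∀ f : (Fin n → ℝ) → ℝ≥0∞, Measurable f →
    ∫⁻ x, (maximal (σ.withDensity f) x) ^ 2 ∂ω ≤ N ^ 2 * ∫⁻ x, (f x) ^ 2 ∂σ}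

/-- The restricted (`D`-`Γ`-doubling) testing constant `𝔗_M^D(Γ)(σ,ω)`: the least `T` with
`∫_Q M(1_Q σ)² dω ≤ T² σ(Q)` for all `Q ∈ 𝒫ⁿ` with `σ(ΓQ) ≤ D σ(Q)`. -/
def testD {n : ℕ} (D Γ : ℝ) (σ ω : Measure (Fin n → ℝ)) : ℝ≥0∞ :=
  sInf {T : ℝ≥0∞ | ∀ Q : Cube n, Q.memP → σ (Q.dilate Γ) ≤ ENNReal.ofReal D * σ Q.toSet →
    ∫⁻ x in Q.toSet, (maximal (σ.restrict Q.toSet) x) ^ 2 ∂ω ≤ T ^ 2 * σ Q.toSet}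

/-! ### Suprema over families of cells of a nested partition -/

section GridSup

variable {X K : Type*}

/-- The cell with label `S.2` at scale `S.1` of the partitions of `X` given by `π`. -/
def cell (π : ℤ → X → K) (S : ℤ × K) : Set X := {x | π S.1 x = S.2}

/-- The partitions become coarser as the scale increases. -/
def Nested (π : ℤ → X → K) : Prop :=
  ∀ ⦃j j' : ℤ⦄, j ≤ j' → ∀ ⦃x y : X⦄, π j x = π j y → π j' x = π j' y

/-- The cells contained in the cell `R`, of scale at most that of `R`. -/
def subcells (π : ℤ → X → K) (R : ℤ × K) : Set (ℤ × K) :=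
  {S | S.1 ≤ R.1 ∧ cell π S ⊆ cell π R}

/-- The supremum of `φ S` over the cells `S` of the family `𝒢` that contain `x`. -/
def gridSup (π : ℤ → X → K) (φ : ℤ × K → ℝ≥0∞) (𝒢 : Set (ℤ × K)) (x : X) : ℝ≥0∞ :=
  ⨆ S ∈ 𝒢, (cell π S).indicator (fun _ => φ S) x

variable {π : ℤ → X → K} {φ : ℤ × K → ℝ≥0∞} {𝒢 : Set (ℤ × K)}

lemma cell_subset_cell (hπ : Nested π) {S R : ℤ × K} (h : S.1 ≤ R.1) {x : X}
    (hS : x ∈ cell π S) (hR : x ∈ cell π R) : cell π S ⊆ cell π R := by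
  intro y hy
  have h1 : π S.1 y = π S.1 x := Eq.trans hy (Eq.symm hS)
  exact Eq.trans (hπ h h1) hR

lemma gridSup_le {x : X} {b : ℝ≥0∞} (h : ∀ S ∈ 𝒢, x ∈ cell π S → φ S ≤ b) :
    gridSup π φ 𝒢 x ≤ b := by
  refine iSup₂_le fun S hS => ?_
  by_cases hx : x ∈ cell π S
  · simpa [hx] using h S hS hx
  · simp [hx]

lemma le_gridSup {S : ℤ × K} (hS : S ∈ 𝒢) {x : X} (hx : x ∈ cell π S) :
    φ S ≤ gridSup π φ 𝒢 x := by
  refine le_trans ?_ (le_iSup₂ (f := fun S (_ : S ∈ 𝒢) =>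
    (cell π S).indicator (fun _ => φ S) x) S hS)
  simp [hx]

variable [MeasurableSpace X] [Countable K]

lemma measurable_gridSup (hm : ∀ S, MeasurableSet (cell π S)) :
    Measurable (gridSup π φ 𝒢) := by
  unfold gridSup
  exact Measurable.iSup fun S => Measurable.iSup fun _ => measurable_const.indicator (hm S)

/-- Localisation to maximal cells: if every cell `R` of the family controls the part of the
supremum that lives below `R`, then the whole supremum is controlled. -/
lemma lintegral_gridSup_le (hπ : Nested π) (hm : ∀ S, MeasurableSet (cell π S))
    (ω ν : Measure X) (c : ℝ≥0∞) (N : ℤ) (U : Set X)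
    (hN : ∀ S ∈ 𝒢, S.1 ≤ N) (hU : ∀ S ∈ 𝒢, cell π S ⊆ U)
    (h : ∀ R ∈ 𝒢, ∫⁻ x, gridSup π φ (𝒢 ∩ subcells π R) x ∂ω ≤ c * ν (cell π R)) :
    ∫⁻ x, gridSup π φ 𝒢 x ∂ω ≤ c * ν U := by
  set 𝓜 : Set (ℤ × K) := {R | R ∈ 𝒢 ∧ ∀ S ∈ 𝒢, ∀ x ∈ cell π R, x ∈ cell π S → S.1 ≤ R.1}
    with h𝓜
  have hdisj : Pairwise (Function.onFun Disjoint fun R : 𝓜 => cell π (R : ℤ × K)) := by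
    rintro ⟨R, hR⟩ ⟨S, hS⟩ hne
    refine Set.disjoint_left.2 fun x hxR hxS => hne ?_
    have h1 : R.1 = S.1 := le_antisymm (hS.2 R hR.1 x hxS hxR) (hR.2 S hS.1 x hxR hxS)
    have h2 : R.2 = S.2 := by
      have hxR' : π R.1 x = R.2 := hxR
      have hxS' : π S.1 x = S.2 := hxS
      rw [← hxR', ← hxS', h1]
    exact Subtype.ext (Prod.ext h1 h2)
  have hpt : ∀ x, gridSup π φ 𝒢 x ≤
      ∑' R : 𝓜, gridSup π φ (𝒢 ∩ subcells π (R : ℤ × K)) x := by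
    intro x
    by_cases hx : ∃ S ∈ 𝒢, x ∈ cell π S
    · obtain ⟨S₀, hS₀, hxS₀⟩ := hx
      obtain ⟨j, ⟨R, hR, hxR, rfl⟩, hmax⟩ := Int.exists_greatest_of_bdd
        (P := fun j => ∃ S ∈ 𝒢, x ∈ cell π S ∧ S.1 = j)
        ⟨N, by rintro z ⟨S, hS, -, rfl⟩; exact hN S hS⟩ ⟨S₀.1, S₀, hS₀, hxS₀, rfl⟩
      have hRM : R ∈ 𝓜 := by
        refine ⟨hR, fun S hS y hyR hyS => ?_⟩
        by_contra hlt
        have := cell_subset_cell hπ (le_of_lt (not_le.1 hlt)) hyR hyS hxR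
        exact hlt (hmax S.1 ⟨S, hS, this, rfl⟩)
      refine le_trans ?_ (ENNReal.le_tsum (⟨R, hRM⟩ : 𝓜))
      refine gridSup_le fun S hS hxS => ?_
      have hle := hmax S.1 ⟨S, hS, hxS, rfl⟩
      exact le_gridSup (π := π) (φ := φ) (𝒢 := 𝒢 ∩ subcells π R)
        ⟨hS, hle, cell_subset_cell hπ hle hxS hxR⟩ hxS
    · refine gridSup_le fun S hS hxS => (hx ⟨S, hS, hxS⟩).elim
  calc ∫⁻ x, gridSup π φ 𝒢 x ∂ω
      ≤ ∫⁻ x, ∑' R : 𝓜, gridSup π φ (𝒢 ∩ subcells π (R : ℤ × K)) x ∂ω := lintegral_mono hpt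
    _ = ∑' R : 𝓜, ∫⁻ x, gridSup π φ (𝒢 ∩ subcells π (R : ℤ × K)) x ∂ω :=
        lintegral_tsum fun R => (measurable_gridSup hm).aemeasurable
    _ ≤ ∑' R : 𝓜, c * ν (cell π (R : ℤ × K)) := ENNReal.tsum_le_tsum fun R => h R R.2.1
    _ = c * ν (⋃ R : 𝓜, cell π (R : ℤ × K)) := by
        rw [ENNReal.tsum_mul_left, measure_iUnion hdisj fun R => hm R]
    _ ≤ c * ν U := by
        gcongr
        exact Set.iUnion_subset fun R => hU R R.2.1

end GridSup

/-! ### Adjacent dyadic grids -/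

section Grids

variable {n : ℕ}

/-- The relative offset at scale `2 ^ j` of the standard (`false`) and the shifted (`true`)
dyadic grid of the line. -/
def gridOffset (t : Bool) (j : ℤ) : ℝ := if t then (-1) ^ j / 3 else 0

/-- The label of the cube of side `2 ^ j` containing `x` in the grid given by `t`. -/
def gridIndex (t : Fin n → Bool) (j : ℤ) (x : Fin n → ℝ) : Fin n → ℤ :=
  fun i => ⌊x i / 2 ^ j - gridOffset (t i) j⌋

/-- The cells of the grid as cubes. -/
def cellCube (t : Fin n → Bool) (S : ℤ × (Fin n → ℤ)) : Cube n where
  corner i := 2 ^ S.1 * (S.2 i + gridOffset (t i) S.1)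
  side := 2 ^ S.1
  side_pos := by positivity

lemma cellCube_memP (t : Fin n → Bool) (S : ℤ × (Fin n → ℤ)) : (cellCube t S).memP :=
  ⟨S.1, rfl⟩

lemma mem_cell_iff {t : Fin n → Bool} {S : ℤ × (Fin n → ℤ)} {x : Fin n → ℝ} :
    x ∈ cell (gridIndex t) S ↔ ∀ i, 2 ^ S.1 * (S.2 i + gridOffset (t i) S.1) ≤ x i ∧
      x i < 2 ^ S.1 * (S.2 i + 1 + gridOffset (t i) S.1) := by
  have hp : (0 : ℝ) < 2 ^ S.1 := by positivity
  simp only [cell, gridIndex, Set.mem_ofPred_eq, funext_iff, Int.floor_eq_iff]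
  refine forall_congr' fun i => and_congr ?_ ?_
  · rw [le_sub_iff_add_le, le_div_iff₀ hp, mul_comm]
  · rw [sub_lt_iff_lt_add, div_lt_iff₀ hp, mul_comm]

lemma cell_eq_toSet (t : Fin n → Bool) (S : ℤ × (Fin n → ℤ)) :
    cell (gridIndex t) S = (cellCube t S).toSet := by
  ext x
  rw [mem_cell_iff]
  refine forall_congr' fun i => and_congr Iff.rfl ?_
  simp only [cellCube]
  ring_nf

lemma nested_gridIndex (t : Fin n → Bool) : Nested (gridIndex t) := by
  intro j j' hj x y h
  induction j', hj using Int.leInduction with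
  | base => exact h
  | succ j' _ ih =>
    funext i
    have ihi := congrFun ih i
    obtain ⟨c, hc⟩ : ∃ c : ℤ, gridOffset (t i) j' - 2 * gridOffset (t i) (j' + 1) = c := by
      unfold gridOffset
      split_ifs
      · refine ⟨if Even j' then 1 else -1, ?_⟩
        rw [zpow_add_one₀ (by norm_num)]
        split_ifs with he
        · rw [he.neg_one_zpow]; norm_num
        · rw [(Int.not_even_iff_odd.1 he).neg_one_zpow]; norm_num
      · exact ⟨0, by simp⟩
    have key : ∀ z : Fin n → ℝ, gridIndex t (j' + 1) z i = (gridIndex t j' z i + c) / 2 := by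
      intro z
      have h1 : z i / 2 ^ (j' + 1) - gridOffset (t i) (j' + 1) =
          ((z i / 2 ^ j' - gridOffset (t i) j') + c) / 2 := by
        rw [← hc, zpow_add_one₀ (by norm_num)]
        field_simp
        ring
      have h2 : (2 : ℝ) = ((2 : ℕ) : ℝ) := by norm_num
      simp only [gridIndex]
      rw [h1, ← Int.floor_add_intCast, h2, Int.floor_div_natCast]
      rfl
    rw [key, key, ihi]

lemma toSet_eq_pi (Q : Cube n) :
    Q.toSet = Set.pi univ fun i => Ico (Q.corner i) (Q.corner i + Q.side) := by
  ext x
  simp [Cube.toSet]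

lemma measurableSet_toSet (Q : Cube n) : MeasurableSet Q.toSet := by
  rw [toSet_eq_pi]
  exact MeasurableSet.univ_pi fun i => measurableSet_Ico

lemma measurableSet_cell (t : Fin n → Bool) (S : ℤ × (Fin n → ℤ)) :
    MeasurableSet (cell (gridIndex t) S) := by
  rw [cell_eq_toSet]
  exact measurableSet_toSet _

lemma volume_toSet (Q : Cube n) : volume Q.toSet = ENNReal.ofReal Q.side ^ n := by
  rw [toSet_eq_pi, Real.volume_pi_Ico]
  simp

lemma measure_toSet_ne_top (σ : Measure (Fin n → ℝ)) [IsLocallyFiniteMeasure σ] (Q : Cube n) :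
    σ Q.toSet ≠ ⊤ := by
  have hb : Q.toSet ⊆ Icc Q.corner fun i => Q.corner i + Q.side :=
    fun x hx => ⟨fun i => (hx i).1, fun i => (hx i).2.le⟩
  exact ((measure_mono hb).trans_lt isCompact_Icc.measure_lt_top).ne

lemma measure_cell_ne_top (σ : Measure (Fin n → ℝ)) [IsLocallyFiniteMeasure σ]
    (t : Fin n → Bool) (S : ℤ × (Fin n → ℤ)) : σ (cell (gridIndex t) S) ≠ ⊤ := by
  rw [cell_eq_toSet]
  exact measure_toSet_ne_top σ _

/-- A short interval lies in a cell of one of the two grids of the line. -/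
lemma exists_grid_interval {a b : ℝ} (j : ℤ) (hab : b - a ≤ 2 ^ j / 4) :
    ∃ (t : Bool) (k : ℤ), 2 ^ j * (k + gridOffset t j) ≤ a ∧
      b ≤ 2 ^ j * (k + 1 + gridOffset t j) := by
  have hp : (0 : ℝ) < 2 ^ j := by positivity
  set k := ⌊a / 2 ^ j⌋
  have h1 : 2 ^ j * (k : ℝ) ≤ a := by
    have := Int.floor_le (a / 2 ^ j)
    rwa [le_div_iff₀ hp, mul_comm] at this
  by_cases hb : b ≤ 2 ^ j * (k + 1)
  · exact ⟨false, k, by simpa [gridOffset] using h1, by simpa [gridOffset] using hb⟩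
  · have h2 : a < 2 ^ j * (k + 1 : ℝ) := by
      have := Int.lt_floor_add_one (a / 2 ^ j)
      rwa [div_lt_iff₀ hp, mul_comm] at this
    rcases Int.even_or_odd j with he | ho
    · refine ⟨true, k, ?_, ?_⟩ <;> simp only [gridOffset, if_true, he.neg_one_zpow] <;> linarith
    · refine ⟨true, k + 1, ?_, ?_⟩ <;> simp only [gridOffset, if_true, ho.neg_one_zpow] <;>
        push_cast <;> linarith

/-- A small box lies in a cell of one of the adjacent grids. -/
lemma exists_cell_box {a b : Fin n → ℝ} (j : ℤ) (hab : ∀ i, b i - a i ≤ 2 ^ j / 4) :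
    ∃ (t : Fin n → Bool) (k : Fin n → ℤ),
      {x : Fin n → ℝ | ∀ i, a i ≤ x i ∧ x i < b i} ⊆ cell (gridIndex t) (j, k) := by
  choose t k h using fun i => exists_grid_interval j (hab i)
  refine ⟨t, k, fun x hx => mem_cell_iff.2 fun i => ⟨(h i).1.trans (hx i).1, ?_⟩⟩
  exact (hx i).2.trans_le (h i).2

/-- The volume of a cell of scale `j`. -/
def cellVolume (n : ℕ) (j : ℤ) : ℝ≥0∞ := ENNReal.ofReal (2 ^ j) ^ n

lemma volume_cellCube (t : Fin n → Bool) (S : ℤ × (Fin n → ℤ)) :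
    volume (cellCube t S).toSet = cellVolume n S.1 := volume_toSet _

lemma cellVolume_add (n : ℕ) (j : ℤ) (m : ℕ) :
    cellVolume n (j + m) = 2 ^ (m * n) * cellVolume n j := by
  rw [cellVolume, cellVolume, zpow_add₀ (by norm_num), ENNReal.ofReal_mul (by positivity),
    zpow_natCast, ENNReal.ofReal_pow (by norm_num), mul_pow, ← pow_mul, mul_comm]
  simp

/-- The average of `μ` over a cell is at most `2 ^ (m * n)` times the average over a cell
that contains it and is `m` scales larger. -/
lemma div_cellVolume_le (n : ℕ) (j : ℤ) (m : ℕ) {a b : ℝ≥0∞} (hab : a ≤ b) :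
    a / cellVolume n j ≤ 2 ^ (m * n) * (b / cellVolume n (j + m)) := by
  rw [cellVolume_add, ← mul_div_assoc,
    ENNReal.mul_div_mul_left _ _ (by positivity) (ENNReal.pow_ne_top (by norm_num))]
  gcongr

end Grids

/-! ### Testing conditions on the grids -/

section Testing

variable {n : ℕ}

/-- The squared average of `μ` over a cell. -/
def avgSq (t : Fin n → Bool) (μ : Measure (Fin n → ℝ)) (S : ℤ × (Fin n → ℤ)) : ℝ≥0∞ :=
  (μ (cell (gridIndex t) S) / cellVolume n S.1) ^ 2

/-- The testing condition with constant `T` for the adjacent dyadic maximal functions that use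
only cubes of sides between `2 ^ (-N)` and `2 ^ N`. -/
def GridTesting (σ ω : Measure (Fin n → ℝ)) (N : ℤ) (T : ℝ≥0∞) : Prop :=
  ∀ (t : Fin n → Bool) (Q : ℤ × (Fin n → ℤ)), Q.1 ≤ N →
    ∫⁻ x, gridSup (gridIndex t) (avgSq t σ) ({S | -N ≤ S.1} ∩ subcells (gridIndex t) Q) x ∂ω
      ≤ T * σ (cell (gridIndex t) Q)

lemma avgSq_mul_le_A2 (σ ω : Measure (Fin n → ℝ)) (t : Fin n → Bool) (R : ℤ × (Fin n → ℤ)) :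
    avgSq t σ R * ω (cell (gridIndex t) R) ≤ A2 σ ω * σ (cell (gridIndex t) R) := by
  have h : σ (cell (gridIndex t) R) / cellVolume n R.1 *
      (ω (cell (gridIndex t) R) / cellVolume n R.1) ≤ A2 σ ω := by
    rw [cell_eq_toSet, ← volume_cellCube t R]
    exact le_iSup₂ (f := fun (Q : Cube n) (_ : Q.memP) =>
      (σ Q.toSet / volume Q.toSet) * (ω Q.toSet / volume Q.toSet)) _ (cellCube_memP t R)
  calc avgSq t σ R * ω (cell (gridIndex t) R)
      = σ (cell (gridIndex t) R) / cellVolume n R.1 *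
        (ω (cell (gridIndex t) R) / cellVolume n R.1) * σ (cell (gridIndex t) R) := by
        simp only [avgSq, div_eq_mul_inv]
        ring
    _ ≤ _ := by gcongr

/-- The `A₂` condition controls each single scale. -/
lemma lintegral_gridSup_scale_le (σ ω : Measure (Fin n → ℝ)) (t : Fin n → Bool)
    (Q : ℤ × (Fin n → ℤ)) (j : ℤ) :
    ∫⁻ x, gridSup (gridIndex t) (avgSq t σ) ({S | S.1 = j} ∩ subcells (gridIndex t) Q) x ∂ω
      ≤ A2 σ ω * σ (cell (gridIndex t) Q) := by
  refine lintegral_gridSup_le (nested_gridIndex t) (measurableSet_cell t) ω σ _ j _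
    (fun S hS => le_of_eq hS.1) (fun S hS => hS.2.2) fun R hR => ?_
  refine le_trans ?_ (avgSq_mul_le_A2 σ ω t R)
  rw [← lintegral_indicator_const (measurableSet_cell t R)]
  refine lintegral_mono fun x => gridSup_le fun S hS hxS => ?_
  have hxR : x ∈ cell (gridIndex t) R := hS.2.2 hxS
  have h1 : S.1 = R.1 := hS.1.1.trans (Eq.symm hR.1)
  have h2 : S = R := by
    refine Prod.ext h1 ?_
    have hxR' : gridIndex t R.1 x = R.2 := hxR
    have hxS' : gridIndex t S.1 x = S.2 := hxS
    rw [← hxR', ← hxS', h1]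
  rw [Set.indicator_of_mem hxR, h2]

/-- The `A₂` condition implies the truncated testing condition, with a constant that depends on
the truncation. -/
lemma gridTesting_of_A2 (σ ω : Measure (Fin n → ℝ)) (N : ℤ) :
    GridTesting σ ω N ((Finset.Icc (-N) N).card * A2 σ ω) := by
  intro t Q hQ
  calc ∫⁻ x, gridSup (gridIndex t) (avgSq t σ)
        ({S | -N ≤ S.1} ∩ subcells (gridIndex t) Q) x ∂ω
      ≤ ∫⁻ x, ∑ j ∈ Finset.Icc (-N) N, gridSup (gridIndex t) (avgSq t σ)
        ({S | S.1 = j} ∩ subcells (gridIndex t) Q) x ∂ω := by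
        refine lintegral_mono fun x => gridSup_le fun S hS hxS => ?_
        refine le_trans ?_ (Finset.single_le_sum (fun _ _ => zero_le)
          (Finset.mem_Icc.2 ⟨hS.1, hS.2.1.trans hQ⟩))
        exact le_gridSup (π := gridIndex t) (φ := avgSq t σ)
          (𝒢 := {S' | S'.1 = S.1} ∩ subcells (gridIndex t) Q) ⟨rfl, hS.2⟩ hxS
    _ = ∑ j ∈ Finset.Icc (-N) N, ∫⁻ x, gridSup (gridIndex t) (avgSq t σ)
        ({S | S.1 = j} ∩ subcells (gridIndex t) Q) x ∂ω :=
        lintegral_finsetSum _ fun j _ => measurable_gridSup (measurableSet_cell t)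
    _ ≤ ∑ j ∈ Finset.Icc (-N) N, A2 σ ω * σ (cell (gridIndex t) Q) :=
        Finset.sum_le_sum fun j _ => lintegral_gridSup_scale_le σ ω t Q j
    _ = _ := by rw [Finset.sum_const, nsmul_eq_mul, mul_assoc]

/-- The testing condition with (squared) constant `T`, restricted to doubling cubes. -/
def RestrictedTesting (D Γ : ℝ) (σ ω : Measure (Fin n → ℝ)) (T : ℝ≥0∞) : Prop :=
  ∀ Q : Cube n, Q.memP → σ (Q.dilate Γ) ≤ ENNReal.ofReal D * σ Q.toSet →
    ∫⁻ x in Q.toSet, (maximal (σ.restrict Q.toSet) x) ^ 2 ∂ω ≤ T * σ Q.toSet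

lemma le_maximal (μ : Measure (Fin n → ℝ)) {Q : Cube n} (hQ : Q.memP) {x : Fin n → ℝ}
    (hx : x ∈ Q.toSet) : μ Q.toSet / volume Q.toSet ≤ maximal μ x :=
  le_iSup_of_le Q (le_iSup₂_of_le hQ hx le_rfl)

/-- On a doubling cell the restricted testing condition controls the local grid maximal
function. -/
lemma lintegral_gridSup_le_of_doubling {D Γ : ℝ} {σ ω : Measure (Fin n → ℝ)} {T : ℝ≥0∞}
    (hT : RestrictedTesting D Γ σ ω T) (t : Fin n → Bool) (R : ℤ × (Fin n → ℤ))
    (hR : σ ((cellCube t R).dilate Γ) ≤ ENNReal.ofReal D * σ (cell (gridIndex t) R)) :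
    ∫⁻ x, gridSup (gridIndex t) (avgSq t σ) (subcells (gridIndex t) R) x ∂ω
      ≤ T * σ (cell (gridIndex t) R) := by
  rw [cell_eq_toSet] at hR ⊢
  refine le_trans ?_ (hT _ (cellCube_memP t R) hR)
  rw [← lintegral_indicator (measurableSet_toSet _)]
  refine lintegral_mono fun x => gridSup_le fun S hS hxS => ?_
  have hxR : x ∈ (cellCube t R).toSet := cell_eq_toSet t R ▸ hS.2 hxS
  rw [Set.indicator_of_mem hxR, avgSq]
  gcongr
  have hSR : (cellCube t S).toSet ⊆ (cellCube t R).toSet := by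
    rw [← cell_eq_toSet, ← cell_eq_toSet]
    exact hS.2
  rw [cell_eq_toSet] at hxS
  refine le_trans (le_of_eq ?_) (le_maximal _ (cellCube_memP t S) hxS)
  rw [Measure.restrict_apply (measurableSet_toSet _), Set.inter_eq_self_of_subset_left hSR,
    volume_cellCube, cell_eq_toSet]

end Testing

/-! ### From restricted testing to testing -/

section Improvement

variable {n : ℕ}

lemma exists_two_pow_mul_lt_le {y z : ℝ≥0∞} (hy : y ≠ 0) (hyz : y < z) (hz : z ≠ ⊤) :
    ∃ j : ℕ, 2 ^ j * y < z ∧ z ≤ 2 ^ (j + 1) * y := by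
  have hex : ∃ j : ℕ, z ≤ 2 ^ j * y := by
    obtain ⟨k, hk⟩ := ENNReal.exists_nat_mul_gt hy hz
    refine ⟨k, hk.le.trans ?_⟩
    gcongr
    exact_mod_cast Nat.lt_two_pow_self.le
  classical
  have h0 : Nat.find hex ≠ 0 := by
    intro h
    have := Nat.find_spec hex
    rw [h, pow_zero, one_mul] at this
    exact absurd hyz (not_lt.2 this)
  obtain ⟨j, hj⟩ := Nat.exists_eq_succ_of_ne_zero h0
  refine ⟨j, not_le.1 (Nat.find_min hex (by omega)), ?_⟩
  have := Nat.find_spec hex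
  rwa [hj] at this

lemma toSet_subset_dilate (Q : Cube n) {Γ : ℝ} (hΓ : 1 ≤ Γ) : Q.toSet ⊆ Q.dilate Γ := by
  intro x hx i
  have h : 0 ≤ (Γ - 1) * Q.side / 2 := by
    have := Q.side_pos
    have : 0 ≤ Γ - 1 := by linarith
    positivity
  exact ⟨by linarith [(hx i).1], by linarith [(hx i).2]⟩

/-- The dilate of a cell lies in a cell of comparable size of some adjacent grid. -/
lemma exists_cell_dilate {Γ : ℝ} {m : ℕ} (hm : Γ ≤ 2 ^ m) (t : Fin n → Bool)
    (R : ℤ × (Fin n → ℤ)) : ∃ (t' : Fin n → Bool) (k : Fin n → ℤ),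
      (cellCube t R).dilate Γ ⊆ cell (gridIndex t') (R.1 + (m + 2 : ℕ), k) := by
  refine exists_cell_box _ fun i => ?_
  have hp : (0 : ℝ) < 2 ^ R.1 := by positivity
  have h : Γ * 2 ^ R.1 ≤ 2 ^ m * 2 ^ R.1 := by gcongr
  rw [zpow_add₀ (by norm_num), zpow_natCast, pow_add]
  simp only [cellCube]
  linarith

/-- Control of the nondoubling cells of the grid `t` whose dilates, `M` scales larger, are given by
`dil S`, lie in the grid `t'`, and have about `b` times the mass of the cell. -/
lemma lintegral_gridSup_nondoubling_le {σ ω : Measure (Fin n → ℝ)} {N : ℤ} {G : ℝ≥0∞}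
    (hG : GridTesting σ ω N G) (t t' : Fin n → Bool) (M : ℕ)
    (dil : ℤ × (Fin n → ℤ) → Fin n → ℤ) {b : ℝ≥0∞} (hb : b ≠ 0) (hb' : b ≠ ⊤)
    (𝒢 : Set (ℤ × (Fin n → ℤ))) (Q : ℤ × (Fin n → ℤ)) (h𝒢 : 𝒢 ⊆ subcells (gridIndex t) Q)
    (hN : ∀ S ∈ 𝒢, -N ≤ S.1 ∧ S.1 + M ≤ N)
    (hdil : ∀ S ∈ 𝒢, cell (gridIndex t) S ⊆ cell (gridIndex t') (S.1 + M, dil S))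
    (hlow : ∀ S ∈ 𝒢, b * σ (cell (gridIndex t) S) ≤ σ (cell (gridIndex t') (S.1 + M, dil S)))
    (hup : ∀ S ∈ 𝒢, σ (cell (gridIndex t') (S.1 + M, dil S)) ≤
      2 * b * σ (cell (gridIndex t) S)) :
    ∫⁻ x, gridSup (gridIndex t) (avgSq t σ) 𝒢 x ∂ω ≤
      (2 ^ (M * n)) ^ 2 * (2 * b⁻¹) * G * σ (cell (gridIndex t) Q) := by
  refine lintegral_gridSup_le (nested_gridIndex t) (measurableSet_cell t) ω σ _ Q.1 _
    (fun S hS => (h𝒢 hS).1) (fun S hS => (h𝒢 hS).2) fun R hR => ?_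
  have hpt : ∀ x, gridSup (gridIndex t) (avgSq t σ) (𝒢 ∩ subcells (gridIndex t) R) x ≤
      (b⁻¹ * 2 ^ (M * n)) ^ 2 * gridSup (gridIndex t') (avgSq t' σ)
        ({S | -N ≤ S.1} ∩ subcells (gridIndex t') (R.1 + M, dil R)) x := by
    intro x
    refine gridSup_le fun S hS hxS => ?_
    have hxS' := hdil S hS.1 hxS
    have hxR' := hdil R hR (hS.2.2 hxS)
    have hle : S.1 + (M : ℤ) ≤ R.1 + M := by linarith [hS.2.1]
    have hmem : (S.1 + (M : ℤ), dil S) ∈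
        {S | -N ≤ S.1} ∩ subcells (gridIndex t') (R.1 + M, dil R) := by
      refine ⟨?_, hle, cell_subset_cell (nested_gridIndex t') hle hxS' hxR'⟩
      have := (hN S hS.1).1
      simp only [Set.mem_ofPred_eq]
      omega
    refine le_trans ?_ (mul_le_mul_right (le_gridSup (π := gridIndex t') (φ := avgSq t' σ)
      hmem hxS') _)
    rw [avgSq, avgSq, ← mul_pow]
    gcongr
    calc σ (cell (gridIndex t) S) / cellVolume n S.1
        ≤ (b⁻¹ * σ (cell (gridIndex t') (S.1 + M, dil S))) / cellVolume n S.1 := by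
          gcongr
          rw [← ENNReal.div_eq_inv_mul, ENNReal.le_div_iff_mul_le (Or.inl hb) (Or.inl hb'),
            mul_comm]
          exact hlow S hS.1
      _ = b⁻¹ * (σ (cell (gridIndex t') (S.1 + M, dil S)) / cellVolume n S.1) :=
          mul_div_assoc _ _ _
      _ ≤ b⁻¹ * (2 ^ (M * n) * (σ (cell (gridIndex t') (S.1 + M, dil S)) /
            cellVolume n (S.1 + M))) := by
          gcongr
          exact div_cellVolume_le n S.1 M le_rfl
      _ = _ := by rw [mul_assoc]
  calc ∫⁻ x, gridSup (gridIndex t) (avgSq t σ) (𝒢 ∩ subcells (gridIndex t) R) x ∂ω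
      ≤ ∫⁻ x, (b⁻¹ * 2 ^ (M * n)) ^ 2 * gridSup (gridIndex t') (avgSq t' σ)
        ({S | -N ≤ S.1} ∩ subcells (gridIndex t') (R.1 + M, dil R)) x ∂ω := lintegral_mono hpt
    _ = (b⁻¹ * 2 ^ (M * n)) ^ 2 * ∫⁻ x, gridSup (gridIndex t') (avgSq t' σ)
        ({S | -N ≤ S.1} ∩ subcells (gridIndex t') (R.1 + M, dil R)) x ∂ω :=
        lintegral_const_mul _ (measurable_gridSup (measurableSet_cell t'))
    _ ≤ (b⁻¹ * 2 ^ (M * n)) ^ 2 * (G * (2 * b * σ (cell (gridIndex t) R))) := by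
        gcongr
        refine (hG t' (R.1 + M, dil R) (hN R hR).2).trans ?_
        gcongr
        exact hup R hR
    _ = (b⁻¹ * b) * ((2 ^ (M * n)) ^ 2 * (2 * b⁻¹) * G * σ (cell (gridIndex t) R)) := by ring
    _ = _ := by rw [ENNReal.inv_mul_cancel hb hb', one_mul]

/-- One step of the absorption argument. -/
lemma gridTesting_improve {σ ω : Measure (Fin n → ℝ)} [IsLocallyFiniteMeasure σ]
    {Γ : ℝ} (hΓ : 1 ≤ Γ) {m : ℕ} (hm : Γ ≤ 2 ^ m) {N : ℤ} {T G : ℝ≥0∞}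
    (hT : RestrictedTesting (2 ^ (n + 2 * ((m + 2) * n) + 3)) Γ σ ω T)
    (hG : GridTesting σ ω N G) :
    GridTesting σ ω N (T + (m + 2 : ℕ) * A2 σ ω + G / 2) := by
  intro t Q hQ
  choose dilGrid dil hdil using fun S => exists_cell_dilate hm t S
  have hsub : ∀ S, cell (gridIndex t) S ⊆
      cell (gridIndex (dilGrid S)) (S.1 + (m + 2 : ℕ), dil S) := fun S => by
    rw [cell_eq_toSet]
    exact (toSet_subset_dilate _ hΓ).trans (hdil S)
  set d : ℝ≥0∞ := 2 ^ (n + 2 * ((m + 2) * n) + 3) with hd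
  have hd0 : d ≠ 0 := by positivity
  have hdt : d ≠ ⊤ := ENNReal.pow_ne_top (by norm_num)
  have hdD : ENNReal.ofReal (2 ^ (n + 2 * ((m + 2) * n) + 3)) = d := by
    rw [ENNReal.ofReal_pow (by norm_num)]
    simp [hd]
  set mass : ℤ × (Fin n → ℤ) → ℝ≥0∞ := fun S => σ (cell (gridIndex t) S) with hmass
  set dilMass : ℤ × (Fin n → ℤ) → ℝ≥0∞ := fun S =>
    σ (cell (gridIndex (dilGrid S)) (S.1 + (m + 2 : ℕ), dil S)) with hdilMass
  set 𝒟 : Set (ℤ × (Fin n → ℤ)) := {S | dilMass S ≤ d * mass S} ∩ subcells (gridIndex t) Q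
    with h𝒟
  set 𝒩 : (Fin n → Bool) → ℕ → Set (ℤ × (Fin n → ℤ)) := fun t' j =>
    {S | (-N ≤ S.1 ∧ S.1 + (m + 2 : ℕ) ≤ N) ∧ dilGrid S = t' ∧
      2 ^ j * d * mass S ≤ dilMass S ∧ dilMass S ≤ 2 * (2 ^ j * d) * mass S} ∩
      subcells (gridIndex t) Q with h𝒩
  have hmeas : ∀ 𝒢, Measurable (gridSup (gridIndex t) (avgSq t σ) 𝒢) :=
    fun 𝒢 => measurable_gridSup (measurableSet_cell t)
  have hpt : ∀ x, gridSup (gridIndex t) (avgSq t σ)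
      ({S | -N ≤ S.1} ∩ subcells (gridIndex t) Q) x ≤
      gridSup (gridIndex t) (avgSq t σ) 𝒟 x +
      (∑ i ∈ Finset.range (m + 2), gridSup (gridIndex t) (avgSq t σ)
        ({S | S.1 = N - i} ∩ subcells (gridIndex t) Q) x) +
      ∑ t', ∑' j, gridSup (gridIndex t) (avgSq t σ) (𝒩 t' j) x := by
    intro x
    refine gridSup_le fun S hS hxS => ?_
    by_cases h1 : dilMass S ≤ d * mass S
    · refine le_add_right (le_add_right ?_)
      exact le_gridSup (π := gridIndex t) (φ := avgSq t σ) (𝒢 := 𝒟) ⟨h1, hS.2⟩ hxS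
    by_cases h2 : S.1 + (m + 2 : ℕ) ≤ N
    · by_cases h0 : mass S = 0
      · have : avgSq t σ S = 0 := by
          have : σ (cell (gridIndex t) S) = 0 := h0
          simp [avgSq, this]
        rw [this]
        exact zero_le
      obtain ⟨j, hj, hj'⟩ := exists_two_pow_mul_lt_le (mul_ne_zero hd0 h0) (not_le.1 h1)
        (measure_cell_ne_top σ _ _)
      refine le_add_left ?_
      refine le_trans ?_ (Finset.single_le_sum (fun _ _ => zero_le)
        (Finset.mem_univ (dilGrid S)))
      refine le_trans ?_ (ENNReal.le_tsum j)
      refine le_gridSup (π := gridIndex t) (φ := avgSq t σ) (𝒢 := 𝒩 (dilGrid S) j)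
        ⟨⟨⟨hS.1, h2⟩, rfl, ?_, ?_⟩, hS.2⟩ hxS
      · rw [mul_assoc]
        exact hj.le
      · refine hj'.trans (le_of_eq ?_)
        ring
    · refine le_add_right (le_add_left ?_)
      have hSN : S.1 ≤ N := hS.2.1.trans hQ
      have hi : (N - S.1).toNat ∈ Finset.range (m + 2) := by
        rw [Finset.mem_range]
        omega
      refine le_trans ?_ (Finset.single_le_sum (fun _ _ => zero_le) hi)
      refine le_gridSup (π := gridIndex t) (φ := avgSq t σ)
        (𝒢 := {S' | S'.1 = N - ((N - S.1).toNat : ℤ)} ∩ subcells (gridIndex t) Q)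
        ⟨?_, hS.2⟩ hxS
      simp only [Set.mem_ofPred_eq]
      omega
  have hdoubling : ∫⁻ x, gridSup (gridIndex t) (avgSq t σ) 𝒟 x ∂ω ≤
      T * σ (cell (gridIndex t) Q) := by
    refine lintegral_gridSup_le (nested_gridIndex t) (measurableSet_cell t) ω σ _ Q.1 _
      (fun S hS => hS.2.1) (fun S hS => hS.2.2) fun R hR => ?_
    refine le_trans (lintegral_mono fun x => gridSup_le fun S hS hxS => ?_)
      (lintegral_gridSup_le_of_doubling hT t R ?_)
    · exact le_gridSup (π := gridIndex t) (φ := avgSq t σ) hS.2 hxS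
    · rw [hdD]
      exact (measure_mono (hdil R)).trans hR.1
  have hnondoubling : ∀ t' j, ∫⁻ x, gridSup (gridIndex t) (avgSq t σ) (𝒩 t' j) x ∂ω ≤
      (2 ^ ((m + 2) * n)) ^ 2 * (2 * (2 ^ j * d)⁻¹) * G * σ (cell (gridIndex t) Q) := by
    intro t' j
    refine lintegral_gridSup_nondoubling_le hG t t' (m + 2) dil (b := 2 ^ j * d)
      (mul_ne_zero (by positivity) hd0)
      (ENNReal.mul_ne_top (ENNReal.pow_ne_top (by norm_num)) hdt) _ Q
      (fun S hS => hS.2) (fun S hS => hS.1.1) ?_ ?_ ?_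
    · rintro S ⟨⟨-, rfl, -⟩, -⟩
      exact hsub S
    · rintro S ⟨⟨-, rfl, h, -⟩, -⟩
      exact h
    · rintro S ⟨⟨-, rfl, -, h⟩, -⟩
      exact h
  have hsum : ∑ _t' : Fin n → Bool, ∑' j : ℕ,
      (2 ^ ((m + 2) * n)) ^ 2 * (2 * (2 ^ j * d)⁻¹) * G * σ (cell (gridIndex t) Q) =
      G / 2 * σ (cell (gridIndex t) Q) := by
    have hj : ∀ j : ℕ, (2 ^ ((m + 2) * n)) ^ 2 * (2 * (2 ^ j * d)⁻¹) * G *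
        σ (cell (gridIndex t) Q) = ((2 ^ ((m + 2) * n)) ^ 2 * 2 * d⁻¹ * G *
        σ (cell (gridIndex t) Q)) * 2⁻¹ ^ j := by
      intro j
      rw [ENNReal.mul_inv (Or.inr hdt) (Or.inr hd0), ENNReal.inv_pow]
      ring
    simp_rw [hj]
    rw [ENNReal.tsum_mul_left, ENNReal.tsum_geometric, ENNReal.one_sub_inv_two, inv_inv,
      Finset.sum_const, Finset.card_univ, nsmul_eq_mul]
    have hcard : ((Fintype.card (Fin n → Bool) : ℕ) : ℝ≥0∞) = 2 ^ n := by simp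
    have hd' : d = 2 ^ n * (2 ^ ((m + 2) * n)) ^ 2 * 2 * 2 * 2 := by
      rw [hd]
      ring
    rw [hcard]
    calc 2 ^ n * ((2 ^ ((m + 2) * n)) ^ 2 * 2 * d⁻¹ * G * σ (cell (gridIndex t) Q) * 2)
        = (2⁻¹ * 2) * (2 ^ n * ((2 ^ ((m + 2) * n)) ^ 2 * 2 * d⁻¹ * G *
          σ (cell (gridIndex t) Q) * 2)) := by
          rw [ENNReal.inv_mul_cancel (by norm_num) (by norm_num), one_mul]
      _ = (d * d⁻¹) * (G * 2⁻¹ * σ (cell (gridIndex t) Q)) := by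
          nth_rewrite 2 [hd']
          ring
      _ = _ := by rw [ENNReal.mul_inv_cancel hd0 hdt, one_mul, div_eq_mul_inv]
  calc ∫⁻ x, gridSup (gridIndex t) (avgSq t σ)
        ({S | -N ≤ S.1} ∩ subcells (gridIndex t) Q) x ∂ω
      ≤ ∫⁻ x, (gridSup (gridIndex t) (avgSq t σ) 𝒟 x +
        (∑ i ∈ Finset.range (m + 2), gridSup (gridIndex t) (avgSq t σ)
          ({S | S.1 = N - i} ∩ subcells (gridIndex t) Q) x) +
        ∑ t', ∑' j, gridSup (gridIndex t) (avgSq t σ) (𝒩 t' j) x) ∂ω := lintegral_mono hpt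
    _ = ∫⁻ x, gridSup (gridIndex t) (avgSq t σ) 𝒟 x ∂ω +
        (∑ i ∈ Finset.range (m + 2), ∫⁻ x, gridSup (gridIndex t) (avgSq t σ)
          ({S | S.1 = N - i} ∩ subcells (gridIndex t) Q) x ∂ω) +
        ∑ t', ∑' j, ∫⁻ x, gridSup (gridIndex t) (avgSq t σ) (𝒩 t' j) x ∂ω := by
        rw [lintegral_add_left, lintegral_add_left (hmeas _), lintegral_finsetSum,
          lintegral_finsetSum]
        · congr 1
          refine Finset.sum_congr rfl fun t' _ => ?_
          exact lintegral_tsum fun j => (hmeas _).aemeasurable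
        · exact fun t' _ => Measurable.tsum fun j => hmeas _
        · exact fun i _ => hmeas _
        · exact (hmeas _).add (Finset.measurable_fun_sum _ fun i _ => hmeas _)
    _ ≤ T * σ (cell (gridIndex t) Q) +
        (∑ i ∈ Finset.range (m + 2), A2 σ ω * σ (cell (gridIndex t) Q)) +
        ∑ _t' : Fin n → Bool, ∑' j : ℕ,
          (2 ^ ((m + 2) * n)) ^ 2 * (2 * (2 ^ j * d)⁻¹) * G * σ (cell (gridIndex t) Q) := by
        gcongr with i _ t' _ j
        · exact lintegral_gridSup_scale_le σ ω t Q _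
        · exact hnondoubling t' j
    _ = _ := by
        rw [hsum, Finset.sum_const, Finset.card_range, nsmul_eq_mul]
        ring

/-- Restricted testing together with `A₂` implies testing on all cells, uniformly in the
truncation. -/
lemma gridTesting_of_restrictedTesting {σ ω : Measure (Fin n → ℝ)} [IsLocallyFiniteMeasure σ]
    {Γ : ℝ} (hΓ : 1 ≤ Γ) {m : ℕ} (hm : Γ ≤ 2 ^ m) (N : ℤ) {T : ℝ≥0∞} (hA : A2 σ ω ≠ ⊤)
    (hT : RestrictedTesting (2 ^ (n + 2 * ((m + 2) * n) + 3)) Γ σ ω T) :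
    GridTesting σ ω N (2 * (T + (m + 2 : ℕ) * A2 σ ω)) := by
  set a := T + (m + 2 : ℕ) * A2 σ ω with ha
  set G := (Finset.Icc (-N) N).card * A2 σ ω with hG
  have hGt : G ≠ ⊤ := ENNReal.mul_ne_top (by simp) hA
  have hiter : ∀ i : ℕ, GridTesting σ ω N (2 * a + G * 2⁻¹ ^ i) := by
    intro i
    induction i with
    | zero =>
      intro t Q hQ
      refine (gridTesting_of_A2 σ ω N t Q hQ).trans ?_
      gcongr
      simp [hG]
    | succ i ih =>
      have h := gridTesting_improve hΓ hm hT ih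
      have h1 : (2 : ℝ≥0∞)⁻¹ * (2 * a) = a := by
        rw [← mul_assoc, ENNReal.inv_mul_cancel (by norm_num) (by norm_num), one_mul]
      have h2 : a + (2 * a + G * 2⁻¹ ^ i) / 2 = 2 * a + G * 2⁻¹ ^ (i + 1) := by
        rw [ENNReal.div_eq_inv_mul, mul_add, h1, pow_succ, two_mul]
        ring
      exact h2 ▸ h
  intro t Q hQ
  have hlim : Tendsto (fun i : ℕ => (2 * a + G * 2⁻¹ ^ i) * σ (cell (gridIndex t) Q)) atTop
      (nhds ((2 * a + G * 0) * σ (cell (gridIndex t) Q))) := by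
    refine ENNReal.Tendsto.mul_const ?_ (Or.inr (measure_cell_ne_top σ t Q))
    refine tendsto_const_nhds.add (ENNReal.Tendsto.const_mul ?_ (Or.inr hGt))
    exact ENNReal.tendsto_pow_atTop_nhds_zero_of_lt_one (by norm_num)
  rw [mul_zero, add_zero] at hlim
  exact ge_of_tendsto' hlim fun i => hiter i t Q hQ

end Improvement

/-! ### From testing to the norm inequality -/

section Norm

variable {n : ℕ}

lemma tsum_two_zpow_le (y : ℝ≥0∞) :
    ∑' k : ℤ, (if (2 : ℝ≥0∞) ^ (k - 1) < y then (2 : ℝ≥0∞) ^ k else 0) ≤ 4 * y := by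
  rcases eq_or_ne y 0 with rfl | h0
  · simp
  rcases eq_or_ne y ⊤ with rfl | ht
  · simp
  obtain ⟨L, hL, hL'⟩ := ENNReal.exists_mem_Ioc_zpow h0 ht (y := 2) (by norm_num) (by norm_num)
  have hinj : Function.Injective fun i : ℕ => L + 1 - (i : ℤ) := by
    intro i j hij
    simp only at hij
    omega
  rw [← hinj.tsum_eq]
  · calc ∑' i : ℕ, (if (2 : ℝ≥0∞) ^ (L + 1 - (i : ℤ) - 1) < y then
          (2 : ℝ≥0∞) ^ (L + 1 - (i : ℤ)) else 0)
        ≤ ∑' i : ℕ, 2 ^ (L + 1) * 2⁻¹ ^ i := by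
          refine ENNReal.tsum_le_tsum fun i => ?_
          split_ifs
          · rw [ENNReal.zpow_sub (by norm_num) (by norm_num), zpow_natCast, ENNReal.inv_pow]
          · exact zero_le
      _ = 2 ^ L * 2 * 2 := by
          rw [ENNReal.tsum_mul_left, ENNReal.tsum_geometric, ENNReal.one_sub_inv_two, inv_inv,
            ENNReal.zpow_add (by norm_num) (by norm_num), zpow_one]
      _ ≤ y * 2 * 2 := by gcongr
      _ = 4 * y := by ring
  · intro k hk
    have hk' : (2 : ℝ≥0∞) ^ (k - 1) < y := by
      by_contra h
      simp [h] at hk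
    refine ⟨(L + 1 - k).toNat, ?_⟩
    have hlt : k - 1 < L + 1 := by
      by_contra h
      have := ENNReal.zpow_le_of_le (x := 2) (by norm_num) (not_lt.1 h)
      exact absurd (hk'.trans_le hL') (not_lt.2 this)
    simp only
    omega

/-- If the average of `f` over `R` exceeds `2 * p`, then at least half of the mass of `f` on `R`
comes from where `f` exceeds `p`. -/
lemma mul_measure_le_of_average {X : Type*} [MeasurableSpace X] (σ : Measure X) {f : X → ℝ≥0∞}
    (hf : Measurable f) {R : Set X} (hR : MeasurableSet R) (hσ : σ R ≠ ⊤) {p : ℝ≥0∞}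
    (hp : p ≠ ⊤) (h : 2 * p * σ R < σ.withDensity f R) :
    p * σ R ≤ (σ.withDensity f).restrict {x | p < f x} R := by
  have hmeas : MeasurableSet {x | p < f x} := measurableSet_lt measurable_const hf
  rw [Measure.restrict_apply hR]
  have hdiff : σ.withDensity f (R \ {x | p < f x}) ≤ p * σ R := by
    rw [withDensity_apply _ (hR.diff hmeas)]
    calc ∫⁻ x in R \ {x | p < f x}, f x ∂σ
        ≤ ∫⁻ _ in R \ {x | p < f x}, p ∂σ :=
          setLIntegral_mono measurable_const fun x hx => not_lt.1 hx.2
      _ = p * σ (R \ {x | p < f x}) := setLIntegral_const _ _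
      _ ≤ p * σ R := by
          gcongr
          exact Set.sdiff_subset
  by_contra hlt
  have h2 := (h.trans_eq (measure_inter_add_sdiff R hmeas).symm).trans (ENNReal.add_lt_add_of_lt_of_le
    (ne_top_of_le_ne_top (ENNReal.mul_ne_top hp hσ) hdiff) (not_le.1 hlt) hdiff)
  rw [mul_assoc, two_mul] at h2
  exact lt_irrefl _ h2

/-- The two-weight inequality for a truncated dyadic maximal function, from testing. -/
lemma lintegral_gridSup_withDensity_le {σ ω : Measure (Fin n → ℝ)} [IsLocallyFiniteMeasure σ]
    {N : ℤ} {B : ℝ≥0∞} (hB : GridTesting σ ω N B) {f : (Fin n → ℝ) → ℝ≥0∞} (hf : Measurable f)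
    (hf2 : ∫⁻ x, f x ^ 2 ∂σ ≠ ⊤) (t : Fin n → Bool) :
    ∫⁻ x, gridSup (gridIndex t) (avgSq t (σ.withDensity f)) {S | -N ≤ S.1 ∧ S.1 ≤ N} x ∂ω ≤
      32 * B * ∫⁻ x, f x ^ 2 ∂σ := by
  set μ := σ.withDensity f with hμ
  have hμt : ∀ S, μ (cell (gridIndex t) S) ≠ ⊤ := by
    intro S
    rw [hμ, withDensity_apply _ (measurableSet_cell t S)]
    have hle : ∀ y : ℝ≥0∞, y ≤ 1 + y ^ 2 := by
      intro y
      rcases le_total y 1 with hy | hy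
      · exact le_add_right hy
      · refine le_add_left ?_
        rw [sq]
        exact le_mul_of_one_le_left zero_le hy
    have h1 : ∫⁻ x in cell (gridIndex t) S, f x ∂σ ≤
        σ (cell (gridIndex t) S) + ∫⁻ x, f x ^ 2 ∂σ :=
      calc ∫⁻ x in cell (gridIndex t) S, f x ∂σ
          ≤ ∫⁻ x in cell (gridIndex t) S, (1 + f x ^ 2) ∂σ := lintegral_mono fun x => hle _
        _ = σ (cell (gridIndex t) S) + ∫⁻ x in cell (gridIndex t) S, f x ^ 2 ∂σ := by
            rw [lintegral_add_left measurable_const, setLIntegral_one]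
        _ ≤ _ := by
            exact add_le_add_right (setLIntegral_le_lintegral _ _) _
    exact ne_top_of_le_ne_top (ENNReal.add_ne_top.2 ⟨measure_cell_ne_top σ t S, hf2⟩) h1
  set 𝒢 : ℤ → Set (ℤ × (Fin n → ℤ)) := fun k => {S | (-N ≤ S.1 ∧ S.1 ≤ N) ∧
    2 ^ k * σ (cell (gridIndex t) S) < μ (cell (gridIndex t) S) ∧
    μ (cell (gridIndex t) S) ≤ 2 ^ (k + 1) * σ (cell (gridIndex t) S)} with h𝒢
  have hmeas : ∀ 𝒢, Measurable (gridSup (gridIndex t) (avgSq t μ) 𝒢) :=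
    fun 𝒢 => measurable_gridSup (measurableSet_cell t)
  have hmeas' : ∀ k : ℤ, MeasurableSet {x | (2 : ℝ≥0∞) ^ (k - 1) < f x} :=
    fun k => measurableSet_lt measurable_const hf
  have hpt : ∀ x, gridSup (gridIndex t) (avgSq t μ) {S | -N ≤ S.1 ∧ S.1 ≤ N} x ≤
      ∑' k, gridSup (gridIndex t) (avgSq t μ) (𝒢 k) x := by
    intro x
    refine gridSup_le fun S hS hxS => ?_
    by_cases h0 : μ (cell (gridIndex t) S) = 0
    · simp [avgSq, h0]
    have hσ0 : σ (cell (gridIndex t) S) ≠ 0 :=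
      fun h => h0 (withDensity_absolutelyContinuous σ f h)
    have hσt := measure_cell_ne_top σ t S
    obtain ⟨k, hk, hk'⟩ := ENNReal.exists_mem_Ioc_zpow (ENNReal.div_ne_zero.2 ⟨h0, hσt⟩)
      (ENNReal.div_ne_top (hμt S) hσ0) (y := 2) (by norm_num) (by norm_num)
    refine le_trans ?_ (ENNReal.le_tsum k)
    refine le_gridSup (π := gridIndex t) (φ := avgSq t μ) (𝒢 := 𝒢 k) ⟨hS, ?_, ?_⟩ hxS
    · rwa [ENNReal.lt_div_iff_mul_lt (Or.inl hσ0) (Or.inl hσt)] at hk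
    · rwa [ENNReal.div_le_iff hσ0 hσt] at hk'
  have hlevel : ∀ k : ℤ, ∫⁻ x, gridSup (gridIndex t) (avgSq t μ) (𝒢 k) x ∂ω ≤
      8 * B * (2 ^ k * μ {x | (2 : ℝ≥0∞) ^ (k - 1) < f x}) := by
    intro k
    set p : ℝ≥0∞ := 2 ^ (k - 1) with hp
    have hk : (2 : ℝ≥0∞) ^ k = 2 * p := by
      have h := ENNReal.zpow_add (x := 2) (by norm_num) (by norm_num) (k - 1) 1
      rwa [sub_add_cancel, zpow_one, mul_comm] at h
    have hk1 : (2 : ℝ≥0∞) ^ (k + 1) = 4 * p := by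
      rw [ENNReal.zpow_add (by norm_num) (by norm_num), hk, zpow_one]
      ring
    have hpt : p ≠ ⊤ := (ENNReal.zpow_lt_top (by norm_num) (by norm_num) _).ne
    have hmain : ∫⁻ x, gridSup (gridIndex t) (avgSq t μ) (𝒢 k) x ∂ω ≤
        16 * p * B * μ.restrict {x | p < f x} univ := by
      refine lintegral_gridSup_le (nested_gridIndex t) (measurableSet_cell t) ω _ _ N _
        (fun S hS => hS.1.2) (fun S hS => Set.subset_univ _) fun R hR => ?_
      have hR2 := hR.2.1
      rw [hk] at hR2
      have hhalf := mul_measure_le_of_average σ hf (measurableSet_cell t R)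
        (measure_cell_ne_top σ t R) hpt hR2
      calc ∫⁻ x, gridSup (gridIndex t) (avgSq t μ) (𝒢 k ∩ subcells (gridIndex t) R) x ∂ω
          ≤ ∫⁻ x, (4 * p) ^ 2 * gridSup (gridIndex t) (avgSq t σ)
            ({S | -N ≤ S.1} ∩ subcells (gridIndex t) R) x ∂ω := by
            refine lintegral_mono fun x => gridSup_le fun S hS hxS => ?_
            refine le_trans ?_ (mul_le_mul_right (le_gridSup (π := gridIndex t)
              (φ := avgSq t σ) (𝒢 := {S | -N ≤ S.1} ∩ subcells (gridIndex t) R) (S := S) ⟨hS.1.1.1, hS.2⟩ hxS) _)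
            rw [avgSq, avgSq, ← mul_pow, ← mul_div_assoc, ← hk1]
            gcongr
            exact hS.1.2.2
        _ = (4 * p) ^ 2 * ∫⁻ x, gridSup (gridIndex t) (avgSq t σ)
            ({S | -N ≤ S.1} ∩ subcells (gridIndex t) R) x ∂ω :=
            lintegral_const_mul _ (measurable_gridSup (measurableSet_cell t))
        _ ≤ (4 * p) ^ 2 * (B * σ (cell (gridIndex t) R)) := by
            gcongr
            exact hB t R hR.1.2
        _ = 16 * p * B * (p * σ (cell (gridIndex t) R)) := by ring
        _ ≤ _ := by gcongr
    rw [Measure.restrict_apply_univ] at hmain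
    refine hmain.trans (le_of_eq ?_)
    rw [hk]
    ring
  calc ∫⁻ x, gridSup (gridIndex t) (avgSq t μ) {S | -N ≤ S.1 ∧ S.1 ≤ N} x ∂ω
      ≤ ∫⁻ x, ∑' k, gridSup (gridIndex t) (avgSq t μ) (𝒢 k) x ∂ω := lintegral_mono hpt
    _ = ∑' k, ∫⁻ x, gridSup (gridIndex t) (avgSq t μ) (𝒢 k) x ∂ω :=
        lintegral_tsum fun k => (hmeas _).aemeasurable
    _ ≤ ∑' k : ℤ, 8 * B * (2 ^ k * μ {x | (2 : ℝ≥0∞) ^ (k - 1) < f x}) :=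
        ENNReal.tsum_le_tsum hlevel
    _ = 8 * B * ∫⁻ x, ∑' k : ℤ,
        2 ^ k * {x | (2 : ℝ≥0∞) ^ (k - 1) < f x}.indicator f x ∂σ := by
        rw [ENNReal.tsum_mul_left, lintegral_tsum fun k =>
          ((hf.indicator (hmeas' k)).const_mul _).aemeasurable]
        congr 2
        funext k
        rw [lintegral_const_mul _ (hf.indicator (hmeas' k)), lintegral_indicator (hmeas' k),
          hμ, withDensity_apply _ (hmeas' k)]
    _ ≤ 8 * B * ∫⁻ x, 4 * f x ^ 2 ∂σ := by
        gcongr with x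
        calc ∑' k : ℤ, 2 ^ k * {x | (2 : ℝ≥0∞) ^ (k - 1) < f x}.indicator f x
            = (∑' k : ℤ, (if (2 : ℝ≥0∞) ^ (k - 1) < f x then (2 : ℝ≥0∞) ^ k else 0)) * f x := by
              rw [← ENNReal.tsum_mul_right]
              congr 1
              funext k
              simp only [Set.indicator_apply, Set.mem_ofPred_eq]
              split_ifs <;> simp
          _ ≤ 4 * f x * f x := by
              gcongr
              exact tsum_two_zpow_le _
          _ = 4 * f x ^ 2 := by ring
    _ = 32 * B * ∫⁻ x, f x ^ 2 ∂σ := by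
        rw [lintegral_const_mul _ (hf.pow_const 2)]
        ring

/-- The maximal function is controlled by the adjacent dyadic maximal functions. -/
lemma maximal_sq_le (μ : Measure (Fin n → ℝ)) (x : Fin n → ℝ) :
    maximal μ x ^ 2 ≤ (2 ^ (2 * n)) ^ 2 * ∑ t : Fin n → Bool, ⨆ N : ℕ,
      gridSup (gridIndex t) (avgSq t μ) {S | -(N : ℤ) ≤ S.1 ∧ S.1 ≤ N} x := by
  rw [← ENNReal.rpow_natCast, ← ENNReal.le_rpow_inv_iff (by norm_num)]
  refine iSup_le fun Q => iSup₂_le fun hQ hx => ?_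
  rw [ENNReal.le_rpow_inv_iff (by norm_num), ENNReal.rpow_natCast]
  obtain ⟨j, hj⟩ := hQ
  obtain ⟨t, k, htk⟩ := exists_cell_box (a := Q.corner) (b := fun i => Q.corner i + Q.side)
    (j + (2 : ℕ)) (fun i => by rw [hj, zpow_add₀ (by norm_num), zpow_natCast]; linarith)
  have hsub : Q.toSet ⊆ cell (gridIndex t) (j + (2 : ℕ), k) := htk
  have h1 : (μ Q.toSet / volume Q.toSet) ^ 2 ≤
      (2 ^ (2 * n)) ^ 2 * avgSq t μ (j + (2 : ℕ), k) := by
    rw [avgSq, ← mul_pow, volume_toSet, hj]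
    gcongr
    exact div_cellVolume_le n j 2 (measure_mono hsub)
  refine h1.trans ?_
  gcongr
  refine le_trans ?_ (Finset.single_le_sum (fun _ _ => zero_le) (Finset.mem_univ t))
  refine le_iSup_of_le (j + (2 : ℕ)).natAbs ?_
  have hmem : (j + ((2 : ℕ) : ℤ), k) ∈ {S : ℤ × (Fin n → ℤ) |
      -((j + (2 : ℕ)).natAbs : ℤ) ≤ S.1 ∧ S.1 ≤ ((j + (2 : ℕ)).natAbs : ℤ)} := by
    simp only [Set.mem_ofPred_eq]
    omega
  exact le_gridSup (π := gridIndex t) (φ := avgSq t μ) hmem (hsub hx)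

/-- The two-weight inequality for the maximal function, from testing on all truncated grids. -/
lemma lintegral_maximal_sq_le {σ ω : Measure (Fin n → ℝ)} [IsLocallyFiniteMeasure σ]
    {B : ℝ≥0∞} (hB : ∀ N, GridTesting σ ω N B) {f : (Fin n → ℝ) → ℝ≥0∞} (hf : Measurable f)
    (hf2 : ∫⁻ x, f x ^ 2 ∂σ ≠ ⊤) :
    ∫⁻ x, maximal (σ.withDensity f) x ^ 2 ∂ω ≤
      (2 ^ (2 * n)) ^ 2 * 2 ^ n * (32 * B) * ∫⁻ x, f x ^ 2 ∂σ := by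
  have hmeas : ∀ (t : Fin n → Bool) (𝒢 : Set (ℤ × (Fin n → ℤ))),
      Measurable (gridSup (gridIndex t) (avgSq t (σ.withDensity f)) 𝒢) :=
    fun t 𝒢 => measurable_gridSup (measurableSet_cell t)
  calc ∫⁻ x, maximal (σ.withDensity f) x ^ 2 ∂ω
      ≤ ∫⁻ x, (2 ^ (2 * n)) ^ 2 * ∑ t : Fin n → Bool, ⨆ N : ℕ, gridSup (gridIndex t)
        (avgSq t (σ.withDensity f)) {S | -(N : ℤ) ≤ S.1 ∧ S.1 ≤ N} x ∂ω :=
        lintegral_mono fun x => maximal_sq_le _ x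
    _ = (2 ^ (2 * n)) ^ 2 * ∑ t : Fin n → Bool, ⨆ N : ℕ, ∫⁻ x, gridSup (gridIndex t)
        (avgSq t (σ.withDensity f)) {S | -(N : ℤ) ≤ S.1 ∧ S.1 ≤ N} x ∂ω := by
        rw [lintegral_const_mul _ (Finset.measurable_fun_sum _ fun t _ =>
          Measurable.iSup fun N => hmeas t _), lintegral_finsetSum _ fun t _ =>
          Measurable.iSup fun N => hmeas t _]
        congr 1
        refine Finset.sum_congr rfl fun t _ => lintegral_iSup (fun N => hmeas t _) ?_
        intro N N' hN x
        refine gridSup_le fun S hS hxS => ?_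
        have hmem : S ∈ {S : ℤ × (Fin n → ℤ) | -(N' : ℤ) ≤ S.1 ∧ S.1 ≤ N'} := by
          simp only [Set.mem_ofPred_eq] at hS ⊢
          omega
        exact le_gridSup (π := gridIndex t) (φ := avgSq t (σ.withDensity f)) hmem hxS
    _ ≤ (2 ^ (2 * n)) ^ 2 * ∑ _t : Fin n → Bool, 32 * B * ∫⁻ x, f x ^ 2 ∂σ := by
        gcongr with t _
        exact iSup_le fun N => lintegral_gridSup_withDensity_le (hB N) hf hf2 t
    _ = _ := by
        rw [Finset.sum_const, Finset.card_univ, nsmul_eq_mul]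
        have hcard : ((Fintype.card (Fin n → Bool) : ℕ) : ℝ≥0∞) = 2 ^ n := by simp
        rw [hcard]
        ring

end Norm

/-! ### The equivalence -/

section Equivalence

variable {n : ℕ} {σ ω : Measure (Fin n → ℝ)}

/-- The two-weight norm inequality with constant `C`. -/
def NormInequality (σ ω : Measure (Fin n → ℝ)) (C : ℝ≥0∞) : Prop :=
  ∀ f : (Fin n → ℝ) → ℝ≥0∞, Measurable f →
    ∫⁻ x, (maximal (σ.withDensity f) x) ^ 2 ∂ω ≤ C * ∫⁻ x, (f x) ^ 2 ∂σ

lemma NormInequality.lintegral_maximal_restrict_le {C : ℝ≥0∞} (h : NormInequality σ ω C)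
    (Q : Cube n) :
    ∫⁻ x in Q.toSet, (maximal (σ.restrict Q.toSet) x) ^ 2 ∂ω ≤ C * σ Q.toSet := by
  have hQ := measurableSet_toSet Q
  have h1 := h (Q.toSet.indicator 1) (measurable_one.indicator hQ)
  rw [withDensity_indicator_one hQ] at h1
  have h2 : ∫⁻ x, (Q.toSet.indicator (1 : (Fin n → ℝ) → ℝ≥0∞) x) ^ 2 ∂σ = σ Q.toSet := by
    rw [← lintegral_indicator_one hQ]
    congr 1
    funext x
    by_cases hx : x ∈ Q.toSet <;> simp [hx]
  rw [h2] at h1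
  exact (setLIntegral_le_lintegral _ _).trans h1

lemma NormInequality.restrictedTesting {C : ℝ≥0∞} (h : NormInequality σ ω C) (D Γ : ℝ) :
    RestrictedTesting D Γ σ ω C :=
  fun Q _ _ => h.lintegral_maximal_restrict_le Q

lemma NormInequality.A2_le [IsLocallyFiniteMeasure σ] {C : ℝ≥0∞} (h : NormInequality σ ω C) :
    A2 σ ω ≤ C := by
  refine iSup₂_le fun Q hQ => ?_
  rcases eq_or_ne (σ Q.toSet) 0 with h0 | h0
  · simp [h0]
  have ht := measure_toSet_ne_top σ Q
  have h1 : (σ Q.toSet / volume Q.toSet) ^ 2 * ω Q.toSet ≤ C * σ Q.toSet := by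
    refine le_trans ?_ (h.lintegral_maximal_restrict_le Q)
    rw [← setLIntegral_const, ← lintegral_indicator (measurableSet_toSet Q),
      ← lintegral_indicator (measurableSet_toSet Q)]
    refine lintegral_mono fun x => ?_
    by_cases hx : x ∈ Q.toSet
    · rw [Set.indicator_of_mem hx, Set.indicator_of_mem hx]
      gcongr
      have := le_maximal (σ.restrict Q.toSet) hQ hx
      rwa [Measure.restrict_apply_self] at this
    · simp [hx]
  refine (ENNReal.mul_le_mul_iff_left h0 ht).1 (le_trans (le_of_eq ?_) h1)
  simp only [div_eq_mul_inv]
  ring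

/-- The cube `[-2 ^ k, 2 ^ k)ⁿ`. -/
def centeredCube (n k : ℕ) : Cube n where
  corner _ := -2 ^ k
  side := 2 ^ (k + 1)
  side_pos := by positivity

lemma centeredCube_mono {k l : ℕ} (h : k ≤ l) :
    (centeredCube n k).toSet ⊆ (centeredCube n l).toSet := by
  intro x hx i
  have hp : (2 : ℝ) ^ k ≤ 2 ^ l := pow_le_pow_right₀ (by norm_num) h
  obtain ⟨h1, h2⟩ := hx i
  simp only [centeredCube, pow_succ] at h1 h2 ⊢
  constructor <;> linarith

lemma iUnion_centeredCube : ⋃ k, (centeredCube n k).toSet = univ := by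
  refine Set.eq_univ_of_forall fun x => Set.mem_iUnion.2 ?_
  obtain ⟨k, hk⟩ := pow_unbounded_of_one_lt (∑ i, |x i|) (one_lt_two : (1 : ℝ) < 2)
  refine ⟨k, fun i => ?_⟩
  have h1 : |x i| < 2 ^ k :=
    (Finset.single_le_sum (f := fun i => |x i|) (fun _ _ => abs_nonneg _)
      (Finset.mem_univ i)).trans_lt hk
  obtain ⟨h2, h3⟩ := abs_lt.1 h1
  simp only [centeredCube, pow_succ]
  constructor <;> linarith

lemma eq_zero_or_eq_zero_of_A2_eq_zero (h : A2 σ ω = 0) : σ = 0 ∨ ω = 0 := by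
  by_contra hne
  push Not at hne
  have hex : ∀ μ : Measure (Fin n → ℝ), μ ≠ 0 → ∃ k, μ (centeredCube n k).toSet ≠ 0 := by
    intro μ hμ
    by_contra hall
    push Not at hall
    apply hμ
    rw [← Measure.measure_univ_eq_zero, ← iUnion_centeredCube]
    exact measure_iUnion_null hall
  obtain ⟨k, hk⟩ := hex σ hne.1
  obtain ⟨l, hl⟩ := hex ω hne.2
  set Q := centeredCube n (max k l)
  have hQ : (σ Q.toSet / volume Q.toSet) * (ω Q.toSet / volume Q.toSet) ≤ 0 := by
    rw [← h]
    exact le_iSup₂ (f := fun (Q : Cube n) (_ : Q.memP) =>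
      (σ Q.toSet / volume Q.toSet) * (ω Q.toSet / volume Q.toSet)) Q
      ⟨((max k l + 1 : ℕ) : ℤ), by rw [zpow_natCast]; rfl⟩
  have hv : volume Q.toSet ≠ ⊤ := measure_toSet_ne_top volume Q
  have hσ : σ Q.toSet ≠ 0 := fun h0 =>
    hk (measure_mono_null (centeredCube_mono (le_max_left k l)) h0)
  have hω : ω Q.toSet ≠ 0 := fun h0 =>
    hl (measure_mono_null (centeredCube_mono (le_max_right k l)) h0)
  exact mul_ne_zero (ENNReal.div_ne_zero.2 ⟨hσ, hv⟩) (ENNReal.div_ne_zero.2 ⟨hω, hv⟩)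
    (le_antisymm hQ zero_le)

lemma normInequality_of_A2_eq_zero (h : A2 σ ω = 0) (C : ℝ≥0∞) : NormInequality σ ω C := by
  intro f _
  rcases eq_zero_or_eq_zero_of_A2_eq_zero h with rfl | rfl
  · simp [maximal, withDensity_zero_left]
  · simp

/-- Restricted testing and `A₂` imply the norm inequality. -/
lemma normInequality_of_restrictedTesting [IsLocallyFiniteMeasure σ] {Γ : ℝ} (hΓ : 1 ≤ Γ)
    {m : ℕ} (hm : Γ ≤ 2 ^ m) {T : ℝ≥0∞} (hA : A2 σ ω ≠ ⊤)
    (hT : RestrictedTesting (2 ^ (n + 2 * ((m + 2) * n) + 3)) Γ σ ω T) :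
    NormInequality σ ω
      ((2 ^ (2 * n)) ^ 2 * 2 ^ n * (32 * (2 * (T + (m + 2 : ℕ) * A2 σ ω)))) := by
  rcases eq_or_ne (A2 σ ω) 0 with h0 | h0
  · exact normInequality_of_A2_eq_zero h0 _
  intro f hf
  rcases eq_or_ne (∫⁻ x, f x ^ 2 ∂σ) ⊤ with hf2 | hf2
  · rw [hf2, ENNReal.mul_top]
    · exact le_top
    · simp [h0]
  · exact lintegral_maximal_sq_le
      (fun N => gridTesting_of_restrictedTesting hΓ hm N hA hT) hf hf2

/-- The infimum defining the restricted testing constant is attained. -/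
lemma restrictedTesting_testD [IsLocallyFiniteMeasure σ] {D Γ : ℝ} (h : testD D Γ σ ω ≠ ⊤) :
    RestrictedTesting D Γ σ ω (testD D Γ σ ω ^ 2) := by
  intro Q hQ hD
  have ht := measure_toSet_ne_top σ Q
  rcases eq_or_ne (σ Q.toSet) 0 with h0 | h0
  · obtain ⟨T, hT, -⟩ := sInf_lt_iff.1 (lt_top_iff_ne_top.2 h)
    have := hT Q hQ hD
    rw [h0, mul_zero] at this ⊢
    exact this
  rw [← ENNReal.div_le_iff h0 ht, ← ENNReal.rpow_natCast,
    ← ENNReal.rpow_inv_le_iff (by norm_num)]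
  refine le_sInf fun T hT => ?_
  rw [ENNReal.rpow_inv_le_iff (by norm_num), ENNReal.rpow_natCast, ENNReal.div_le_iff h0 ht]
  exact hT Q hQ hD

lemma rpow_half_sq (a : ℝ≥0∞) : (a ^ ((1 : ℝ) / 2)) ^ 2 = a := by
  rw [← ENNReal.rpow_natCast, ← ENNReal.rpow_mul]
  norm_num

lemma testD_add_A2_le [IsLocallyFiniteMeasure σ] (D Γ : ℝ) :
    testD D Γ σ ω + A2 σ ω ^ ((1 : ℝ) / 2) ≤ 2 * opNorm σ ω := by
  rw [two_mul]
  refine add_le_add (sInf_le_sInf fun N hN => ?_) (le_sInf fun N hN => ?_)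
  · exact NormInequality.restrictedTesting (C := N ^ 2) hN D Γ
  · have h := NormInequality.A2_le (C := N ^ 2) hN
    rw [one_div, ENNReal.rpow_inv_le_iff (by norm_num)]
    exact_mod_cast h

end Equivalence

/-- **Restricted testing for the maximal function (Theorem 1).**
For every `Γ > 1` there is `D > 1`, depending only on `Γ` and the dimension `n`, such that
`𝔑_M(σ,ω) ≈ 𝔗_M^D(Γ)(σ,ω) + √A₂(σ,ω)` for all locally finite positive Borel measures
`σ, ω` on `ℝⁿ`, with implicit constants depending only on `Γ` and `n`.  In particular, the
norm inequality `∫ M(fσ)² dω ≤ C ∫ f² dσ` holds for all `f ≥ 0` if and only if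
`A₂(σ,ω) < ∞` and the testing inequality `∫_Q M(1_Q σ)² dω ≤ C' σ(Q)` holds for all cubes
`Q ∈ 𝒫ⁿ` with `σ(ΓQ) ≤ D σ(Q)`. -/
theorem restricted_testing_for_maximal_function
    {n : ℕ} (hn : 1 ≤ n) (Γ : ℝ) (hΓ : 1 < Γ) :
    ∃ D : ℝ, 1 < D ∧ ∃ C : ℝ≥0∞, 0 < C ∧ C ≠ ⊤ ∧
      ∀ σ ω : Measure (Fin n → ℝ),
        IsLocallyFiniteMeasure σ → IsLocallyFiniteMeasure ω →
        (opNorm σ ω ≤ C * (testD D Γ σ ω + A2 σ ω ^ ((1:ℝ)/2)) ∧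
          testD D Γ σ ω + A2 σ ω ^ ((1:ℝ)/2) ≤ C * opNorm σ ω) ∧
        ((∃ C' : ℝ≥0∞, C' ≠ ⊤ ∧ ∀ f : (Fin n → ℝ) → ℝ≥0∞, Measurable f →
            ∫⁻ x, (maximal (σ.withDensity f) x) ^ 2 ∂ω ≤ C' * ∫⁻ x, (f x) ^ 2 ∂σ) ↔
          (A2 σ ω ≠ ⊤ ∧ ∃ C' : ℝ≥0∞, C' ≠ ⊤ ∧
            ∀ Q : Cube n, Q.memP → σ (Q.dilate Γ) ≤ ENNReal.ofReal D * σ Q.toSet →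
              ∫⁻ x in Q.toSet, (maximal (σ.restrict Q.toSet) x) ^ 2 ∂ω
                ≤ C' * σ Q.toSet)) := by
  obtain ⟨m, hm⟩ := pow_unbounded_of_one_lt Γ (one_lt_two : (1 : ℝ) < 2)
  set K : ℝ≥0∞ := (2 ^ (2 * n)) ^ 2 * 2 ^ n * 32 * 2 * (m + 2 : ℕ) with hK
  have hKt : K ≠ ⊤ := by simp [hK, ENNReal.mul_eq_top]
  have hpow : ∀ k : ℕ, (1 : ℝ≥0∞) ≤ 2 ^ k := fun k => one_le_pow_of_one_le' one_le_two k
  have hm1 : (1 : ℝ≥0∞) ≤ (m + 2 : ℕ) := by exact_mod_cast (by omega : 1 ≤ m + 2)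
  have hK2 : 2 ≤ K := by
    calc (2 : ℝ≥0∞) = 1 ^ 2 * 1 * 1 * 2 * 1 := by norm_num
      _ ≤ K := by
        rw [hK]
        gcongr
        · exact hpow _
        · exact hpow _
        · norm_num
  refine ⟨2 ^ (n + 2 * ((m + 2) * n) + 3), one_lt_pow₀ one_lt_two (by omega), K,
    lt_of_lt_of_le two_pos hK2, hKt, fun σ ω hσ hω => ⟨⟨?_, ?_⟩, ?_, ?_⟩⟩
  · rcases eq_or_ne (A2 σ ω) ⊤ with hA | hA
    · rw [hA, ENNReal.top_rpow_of_pos (by norm_num), add_top,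
        ENNReal.mul_top (lt_of_lt_of_le two_pos hK2).ne']
      exact le_top
    rcases eq_or_ne (testD (2 ^ (n + 2 * ((m + 2) * n) + 3)) Γ σ ω) ⊤ with hT | hT
    · rw [hT, top_add, ENNReal.mul_top (lt_of_lt_of_le two_pos hK2).ne']
      exact le_top
    refine sInf_le fun f hf => ?_
    refine (normInequality_of_restrictedTesting hΓ.le hm.le hA
      (restrictedTesting_testD hT) f hf).trans ?_
    gcongr
    set T := testD (2 ^ (n + 2 * ((m + 2) * n) + 3)) Γ σ ω
    set a := A2 σ ω ^ ((1 : ℝ) / 2) with ha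
    have ha2 : A2 σ ω = a ^ 2 := (rpow_half_sq _).symm
    rw [ha2]
    calc (2 ^ (2 * n)) ^ 2 * 2 ^ n * (32 * (2 * (T ^ 2 + (m + 2 : ℕ) * a ^ 2)))
        ≤ (2 ^ (2 * n)) ^ 2 * 2 ^ n *
          (32 * (2 * ((m + 2 : ℕ) * T ^ 2 + (m + 2 : ℕ) * a ^ 2))) := by
          gcongr
          exact le_mul_of_one_le_left zero_le hm1
      _ = 1 * K * (T ^ 2 + a ^ 2) := by
          rw [hK]
          ring
      _ ≤ K * K * (T + a) ^ 2 := by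
          gcongr
          · exact one_le_two.trans hK2
          · rw [add_sq']
            exact le_self_add
      _ = (K * (T + a)) ^ 2 := by ring
  · refine (testD_add_A2_le _ Γ).trans ?_
    gcongr
  · rintro ⟨C', hC', h⟩
    have h' : NormInequality σ ω C' := h
    exact ⟨ne_top_of_le_ne_top hC' h'.A2_le, C', hC', h'.restrictedTesting _ Γ⟩
  · rintro ⟨hA, C', hC', h⟩
    refine ⟨_, ?_, normInequality_of_restrictedTesting hΓ.le hm.le hA h⟩
    simp [ENNReal.mul_eq_top, hA, hC']
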